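/- arXiv:1812.09775 — 9 statements merged into one kernel-verified Lean document; each statement's English description precedes it below -/
import Mathlib

section
/- Let G be a finite simple graph on n ≥ 1 vertices with independence polynomial i(G,x) = ∑_{k=0}^{α(G)} i_k x^k. Then for every k with 0 ≤ k ≤ α(G) - 1, the ratio of consecutive coefficients satisfies i_k / i_{k+1} ≤ 3^(n/3) + n - 1 (equivalently, i_k ≤ (3^(n/3) + n - 1)·i_{k+1}). -/
open Finset Polynomial

open scoped Classical in
/-- The number of independent vertex sets of size `k` in the graph `G`. -/
noncomputable def indepCount {V : Type*} [Fintype V] (G : SimpleGraph V) (k : ℕ) : ℕ :=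
  (Finset.univ.filter fun s : Finset V =>
    s.card = k ∧ ∀ u ∈ s, ∀ v ∈ s, ¬ G.Adj u v).card

open scoped Classical in
/-- The independence number of `G` : the maximum size of an independent vertex set. -/
noncomputable def indepNum {V : Type*} [Fintype V] (G : SimpleGraph V) : ℕ :=
  (Finset.univ.filter fun s : Finset V => ∀ u ∈ s, ∀ v ∈ s, ¬ G.Adj u v).sup Finset.card

open scoped Classical in
/-- The independence polynomial of `G` (over `ℂ`): `∑_k i_k x^k`, where `i_k` is the
number of independent vertex sets of size `k`. -/
noncomputable def indepPoly {V : Type*} [Fintype V] (G : SimpleGraph V) : Polynomial ℂ :=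
  ∑ s ∈ Finset.univ.filter (fun s : Finset V => ∀ u ∈ s, ∀ v ∈ s, ¬ G.Adj u v),
    (Polynomial.X : Polynomial ℂ) ^ s.card

theorem three_pow_ge_cube (d : ℕ) : d ^ 3 ≤ 3 ^ d := by
  rcases lt_or_ge d 3 with h | h
  · interval_cases d <;> norm_num
  · induction d, h using Nat.le_induction with
    | base => norm_num
    | succ d hd ih =>
      rw [pow_succ 3 d]
      nlinarith [mul_le_mul hd hd (by norm_num) (by positivity)]

open scoped Classical in
/-- The maximal independent sets of the subgraph of `G` induced on `S`. -/
noncomputable def maxIndepSets {V : Type*} (G : SimpleGraph V) (S : Finset V) :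
    Finset (Finset V) :=
  S.powerset.filter fun M =>
    (∀ u ∈ M, ∀ v ∈ M, ¬ G.Adj u v) ∧ ∀ v ∈ S, v ∉ M → ∃ u ∈ M, G.Adj u v

theorem mem_maxIndepSets {V : Type*} {G : SimpleGraph V} {S M : Finset V} :
    M ∈ maxIndepSets G S ↔ M ⊆ S ∧ (∀ u ∈ M, ∀ v ∈ M, ¬ G.Adj u v) ∧
      ∀ v ∈ S, v ∉ M → ∃ u ∈ M, G.Adj u v := by
  simp [maxIndepSets]

/-- The Moon–Moser bound on the number of maximal independent sets, where `b` is the cube root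
of `3`. -/
theorem card_maxIndepSets_le {V : Type*} (G : SimpleGraph V) {b : ℝ} (hb : 1 ≤ b)
    (hb3 : b ^ 3 = 3) (S : Finset V) : ((maxIndepSets G S).card : ℝ) ≤ b ^ S.card := by
  classical
  induction S using Finset.strongInduction with
  | H S ih =>
  rcases S.eq_empty_or_nonempty with rfl | hS
  · have : (maxIndepSets G (∅ : Finset V)).card ≤ 1 :=
      (card_filter_le _ _).trans (by simp)
    simpa using this
  let N : V → Finset V := fun u => S.filter fun w => w = u ∨ G.Adj u w
  obtain ⟨v, hv, hmin⟩ := S.exists_min_image (fun u => (N u).card) hS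
  have hNS : ∀ u, N u ⊆ S := fun u => filter_subset _ _
  have hself : ∀ u ∈ S, u ∈ N u := fun u hu => by simp [N, hu]
  have hcover : maxIndepSets G S ⊆
      (N v).biUnion fun u => (maxIndepSets G (S \ N u)).image (insert u) := by
    intro M hM
    obtain ⟨hMS, hind, hmax⟩ := mem_maxIndepSets.1 hM
    have key : ∃ u ∈ N v, u ∈ M := by
      by_cases hvM : v ∈ M
      · exact ⟨v, hself v hv, hvM⟩
      · obtain ⟨u, hu, huv⟩ := hmax v hv hvM
        exact ⟨u, by simp [N, hMS hu, huv.symm], hu⟩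
    obtain ⟨u, huN, huM⟩ := key
    refine mem_biUnion.2 ⟨u, huN, mem_image.2 ⟨M.erase u, ?_, insert_erase huM⟩⟩
    refine mem_maxIndepSets.2 ⟨?_, ?_, ?_⟩
    · intro w hw
      obtain ⟨hwu, hwM⟩ := mem_erase.1 hw
      simp [N, hMS hwM, hwu, hind u huM w hwM]
    · exact fun x hx y hy => hind x (mem_of_mem_erase hx) y (mem_of_mem_erase hy)
    · intro w hw hwM
      simp only [N, mem_sdiff, mem_filter, not_and, not_or] at hw
      obtain ⟨hwS, hw⟩ := hw
      obtain ⟨hwu, huw⟩ := hw hwS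
      obtain ⟨x, hx, hxw⟩ := hmax w hwS fun h => hwM (mem_erase.2 ⟨hwu, h⟩)
      refine ⟨x, mem_erase.2 ⟨?_, hx⟩, hxw⟩
      rintro rfl
      exact huw hxw
  have hd : (N v).card ≤ S.card := card_le_card (hNS v)
  have hdb : ((N v).card : ℝ) ≤ b ^ (N v).card := by
    refine le_of_pow_le_pow_left₀ (n := 3) (by norm_num) (by positivity) ?_
    rw [← pow_mul, mul_comm, pow_mul, hb3]
    exact_mod_cast three_pow_ge_cube _
  calc ((maxIndepSets G S).card : ℝ)
      ≤ ∑ u ∈ N v, ((maxIndepSets G (S \ N u)).card : ℝ) := by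
        have h : (maxIndepSets G S).card ≤ ∑ u ∈ N v, (maxIndepSets G (S \ N u)).card :=
          (card_le_card hcover).trans
            (card_biUnion_le.trans (sum_le_sum fun _ _ => card_image_le))
        exact_mod_cast h
    _ ≤ ∑ _u ∈ N v, b ^ (S.card - (N v).card) := by
        refine sum_le_sum fun u hu => ?_
        have huS := hNS v hu
        refine (ih _ (sdiff_ssubset (hNS u) ⟨u, hself u huS⟩)).trans ?_
        rw [card_sdiff_of_subset (hNS u)]
        exact pow_le_pow_right₀ hb (Nat.sub_le_sub_left (hmin u huS) _)
    _ = (N v).card * b ^ (S.card - (N v).card) := by simp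
    _ ≤ b ^ (N v).card * b ^ (S.card - (N v).card) := by gcongr
    _ = b ^ S.card := by rw [← pow_add, Nat.add_sub_cancel' hd]

theorem indepCount_le_choose {V : Type*} [Fintype V] (G : SimpleGraph V) (k : ℕ) :
    indepCount G k ≤ (Fintype.card V).choose k := by
  classical
  rw [← card_univ, ← card_powersetCard]
  refine card_le_card fun s hs => ?_
  simp only [mem_filter, mem_univ, true_and] at hs
  simp [mem_powersetCard, hs.1]

/-- An independent `k`-set is either maximal or contained in an independent `(k + 1)`-set. -/
theorem indepCount_le_add {V : Type*} [Fintype V] (G : SimpleGraph V) (k : ℕ) :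
    indepCount G k ≤ (maxIndepSets G univ).card + indepCount G (k + 1) * (k + 1) := by
  classical
  let T := univ.filter fun s : Finset V => s.card = k + 1 ∧ ∀ u ∈ s, ∀ v ∈ s, ¬ G.Adj u v
  have hT : T.card = indepCount G (k + 1) := by
    unfold indepCount
    congr!
  have hcover : (univ.filter fun s : Finset V => s.card = k ∧ ∀ u ∈ s, ∀ v ∈ s, ¬ G.Adj u v) ⊆
      maxIndepSets G univ ∪ T.biUnion fun t => t.powersetCard k := by
    intro s hs
    simp only [mem_filter, mem_univ, true_and] at hs
    obtain ⟨hsk, hind⟩ := hs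
    by_cases hmax : s ∈ maxIndepSets G univ
    · exact mem_union_left _ hmax
    simp only [mem_maxIndepSets, subset_univ, mem_univ, true_and, forall_const, not_and] at hmax
    have hmax := hmax hind
    push Not at hmax
    obtain ⟨v, hvs, hv⟩ := hmax
    refine mem_union_right _ (mem_biUnion.2 ⟨insert v s, ?_, ?_⟩)
    · simp only [T, mem_filter, mem_univ, true_and]
      refine ⟨by rw [card_insert_of_notMem hvs, hsk], ?_⟩
      intro x hx y hy
      rcases mem_insert.1 hx with rfl | hxs <;> rcases mem_insert.1 hy with rfl | hys
      · exact G.irrefl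
      · exact fun h => hv y hys h.symm
      · exact hv x hxs
      · exact hind x hxs y hys
    · exact mem_powersetCard.2 ⟨subset_insert _ _, hsk⟩
  have hbi : (T.biUnion fun t => t.powersetCard k).card ≤ T.card * (k + 1) := by
    refine card_biUnion_le_card_mul _ _ _ fun t ht => ?_
    rw [card_powersetCard, (mem_filter.1 ht).2.1, Nat.choose_succ_self_right]
  rw [← hT]
  refine le_trans (le_of_eq ?_)
    ((card_le_card hcover).trans ((card_union_le _ _).trans (Nat.add_le_add_left hbi _)))
  unfold indepCount
  congr!

theorem exists_indep_card_eq_indepNum {V : Type*} [Fintype V] (G : SimpleGraph V) :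
    ∃ s : Finset V, s.card = indepNum G ∧ ∀ u ∈ s, ∀ v ∈ s, ¬ G.Adj u v := by
  classical
  obtain ⟨s, hs, h⟩ := exists_mem_eq_sup
    (univ.filter fun s : Finset V => ∀ u ∈ s, ∀ v ∈ s, ¬ G.Adj u v) ⟨∅, by simp⟩ Finset.card
  refine ⟨s, ?_, (mem_filter.1 hs).2⟩
  rw [← h]
  unfold indepNum
  congr!

theorem indepCount_pos {V : Type*} [Fintype V] (G : SimpleGraph V) {k : ℕ}
    (hk : k ≤ indepNum G) : 0 < indepCount G k := by
  obtain ⟨s, hs, hind⟩ := exists_indep_card_eq_indepNum G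
  obtain ⟨t, hts, ht⟩ := exists_subset_card_eq (hk.trans_eq hs.symm)
  refine card_pos.2 ⟨t, ?_⟩
  simp only [mem_filter, mem_univ, true_and]
  exact ⟨ht, fun u hu v hv => hind u (hts hu) v (hts hv)⟩

theorem indepNum_le_card {V : Type*} [Fintype V] (G : SimpleGraph V) :
    indepNum G ≤ Fintype.card V := by
  obtain ⟨s, hs, -⟩ := exists_indep_card_eq_indepNum G
  exact hs ▸ card_le_univ s

/-- For a graph `G` on `n ≥ 1` vertices and `0 ≤ k ≤ α(G) - 1`, the ratio of consecutive
coefficients of the independence polynomial satisfies `i_k / i_{k+1} ≤ 3^(n/3) + n - 1`. -/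
theorem stmt1 {V : Type*} [Fintype V] {n : ℕ} (hn : 1 ≤ n) (hcard : Fintype.card V = n)
    (G : SimpleGraph V) (k : ℕ) (hk : k + 1 ≤ indepNum G) :
    (indepCount G k : ℝ) / (indepCount G (k + 1) : ℝ) ≤ (3 : ℝ) ^ ((n : ℝ) / 3) + n - 1 := by
  have hpos : (1 : ℝ) ≤ indepCount G (k + 1) := by exact_mod_cast indepCount_pos G hk
  have hkn : k + 1 ≤ n := hcard ▸ hk.trans (indepNum_le_card G)
  have hone : (1 : ℝ) ≤ 3 ^ ((n : ℝ) / 3) := Real.one_le_rpow (by norm_num) (by positivity)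
  have hn' : (1 : ℝ) ≤ n := by exact_mod_cast hn
  rw [div_le_iff₀ (by linarith)]
  rcases hkn.eq_or_lt with rfl | hlt
  · have hle : (indepCount G k : ℝ) ≤ (k + 1 : ℕ) := by
      have h := indepCount_le_choose G k
      rw [hcard, Nat.choose_succ_self_right] at h
      exact_mod_cast h
    nlinarith
  · have hb3 : ((3 : ℝ) ^ ((1 : ℝ) / 3)) ^ 3 = 3 := by
      rw [← Real.rpow_mul_natCast (by norm_num)]
      norm_num
    have hmm := card_maxIndepSets_le G (Real.one_le_rpow (by norm_num) (by norm_num)) hb3 univ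
    rw [card_univ, hcard, ← Real.rpow_mul_natCast (by norm_num), one_div_mul_eq_div] at hmm
    have hadd : (indepCount G k : ℝ) ≤
        (maxIndepSets G univ).card + indepCount G (k + 1) * (k + 1) := by
      exact_mod_cast indepCount_le_add G k
    have hk' : (k : ℝ) + 1 + 1 ≤ n := by exact_mod_cast hlt
    nlinarith
end

section
/- Let G be a finite simple graph on n vertices such that G has exactly one independent set of maximum size (ξ(G) = 1). Then the number of independent sets of size α(G) - 1 in G satisfies i_{α(G)-1} ≤ 3^(n/3) + n - 1. -/
open Finset Polynomial

/-- The neighbourhood of `u` within `W`, together with `u` itself when `u ∈ W`. -/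
noncomputable def closedNbhd {V : Type*} (G : SimpleGraph V) (W : Finset V) (u : V) : Finset V :=
  open scoped Classical in W.filter fun w => w = u ∨ G.Adj u w

/-- The maximal independent sets of the subgraph of `G` induced on `W`. -/
noncomputable def maximalIndepSets {V : Type*} (G : SimpleGraph V) (W : Finset V) :
    Finset (Finset V) :=
  open scoped Classical in W.powerset.filter fun s =>
    (∀ u ∈ s, ∀ v ∈ s, ¬ G.Adj u v) ∧ ∀ w ∈ W, w ∈ s ∨ ∃ u ∈ s, G.Adj u w

section

variable {V : Type*} {G : SimpleGraph V} {W s : Finset V} {u v w : V}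

theorem mem_closedNbhd : w ∈ closedNbhd G W u ↔ w ∈ W ∧ (w = u ∨ G.Adj u w) := by
  simp [closedNbhd]

theorem mem_maximalIndepSets : s ∈ maximalIndepSets G W ↔
    s ⊆ W ∧ (∀ u ∈ s, ∀ v ∈ s, ¬ G.Adj u v) ∧ ∀ w ∈ W, w ∈ s ∨ ∃ u ∈ s, G.Adj u w := by
  simp [maximalIndepSets]

/-- Removing a vertex `u` of a maximal independent set leaves a maximal independent set of the
graph without the closed neighbourhood of `u`. -/
theorem erase_mem_maximalIndepSets [DecidableEq V] (hs : s ∈ maximalIndepSets G W) (hu : u ∈ s) :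
    s.erase u ∈ maximalIndepSets G (W \ closedNbhd G W u) := by
  rw [mem_maximalIndepSets] at hs ⊢
  obtain ⟨hsW, hind, hmax⟩ := hs
  refine ⟨fun w hw => ?_, fun a ha b hb => hind a (mem_of_mem_erase ha) b (mem_of_mem_erase hb),
    fun w hw => ?_⟩
  · obtain ⟨hwu, hws⟩ := mem_erase.1 hw
    simp only [mem_sdiff, mem_closedNbhd, not_and, not_or]
    exact ⟨hsW hws, fun _ => ⟨hwu, hind u hu w hws⟩⟩
  · simp only [mem_sdiff, mem_closedNbhd, not_and, not_or] at hw
    obtain ⟨hwu, huw⟩ := hw.2 hw.1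
    rcases hmax w hw.1 with h | ⟨a, ha, haw⟩
    · exact Or.inl (mem_erase.2 ⟨hwu, h⟩)
    · refine Or.inr ⟨a, mem_erase.2 ⟨?_, ha⟩, haw⟩
      rintro rfl
      exact huw haw

/-- Every maximal independent set meets the closed neighbourhood of each vertex. -/
theorem card_maximalIndepSets_le_sum [DecidableEq V] (hv : v ∈ W) :
    (maximalIndepSets G W).card ≤
      ∑ u ∈ closedNbhd G W v, (maximalIndepSets G (W \ closedNbhd G W u)).card := by
  calc (maximalIndepSets G W).card
      ≤ ((closedNbhd G W v).biUnion fun u =>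
          (maximalIndepSets G (W \ closedNbhd G W u)).image (insert u)).card := by
        refine card_le_card fun s hs => ?_
        obtain ⟨hsW, -, hmax⟩ := mem_maximalIndepSets.1 hs
        obtain ⟨u, hu, huv⟩ : ∃ u ∈ s, u = v ∨ G.Adj v u := by
          rcases hmax v hv with h | ⟨u, hu, huv⟩
          · exact ⟨v, h, Or.inl rfl⟩
          · exact ⟨u, hu, Or.inr huv.symm⟩
        exact mem_biUnion.2 ⟨u, mem_closedNbhd.2 ⟨hsW hu, huv⟩,
          mem_image.2 ⟨s.erase u, erase_mem_maximalIndepSets hs hu, insert_erase hu⟩⟩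
    _ ≤ _ := card_biUnion_le.trans (sum_le_sum fun u _ => card_image_le)

theorem pow_three_le_three_pow (k : ℕ) : k ^ 3 ≤ 3 ^ k := by
  rcases lt_or_ge k 3 with hk | hk
  · interval_cases k <;> norm_num
  · induction k, hk using Nat.le_induction with
    | base => norm_num
    | succ k hk ih =>
      rw [pow_succ 3 k]
      nlinarith [mul_le_mul hk hk (Nat.zero_le _) (Nat.zero_le _)]

/-- The **Moon–Moser theorem**, with `r` the cube root of `3`. -/
theorem card_maximalIndepSets_le_pow {r : ℝ} (hr : 1 ≤ r) (hr3 : r ^ 3 = 3) (W : Finset V) :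
    ((maximalIndepSets G W).card : ℝ) ≤ r ^ W.card := by
  classical
  induction W using Finset.strongInduction with
  | H W ih =>
  rcases W.eq_empty_or_nonempty with rfl | hW
  · have : maximalIndepSets G (∅ : Finset V) ⊆ {∅} := fun s hs =>
      mem_singleton.2 (subset_empty.1 (mem_maximalIndepSets.1 hs).1)
    simpa using card_le_card this
  obtain ⟨v, hv, hmin⟩ := exists_min_image W (fun u => (closedNbhd G W u).card) hW
  set k := (closedNbhd G W v).card with hk
  have hsub (u : V) : closedNbhd G W u ⊆ W := fun w hw => (mem_closedNbhd.1 hw).1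
  have hk_le : (k : ℝ) ≤ r ^ k := by
    refine le_of_pow_le_pow_left₀ three_ne_zero (by positivity) ?_
    rw [pow_right_comm, hr3]
    exact_mod_cast pow_three_le_three_pow k
  have hterm : ∀ u ∈ closedNbhd G W v,
      ((maximalIndepSets G (W \ closedNbhd G W u)).card : ℝ) ≤ r ^ (W.card - k) := by
    intro u hu
    have huW := hsub v hu
    have huu : u ∈ closedNbhd G W u := mem_closedNbhd.2 ⟨huW, Or.inl rfl⟩
    refine (ih _ (sdiff_ssubset (hsub u) ⟨u, huu⟩)).trans (pow_le_pow_right₀ hr ?_)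
    rw [card_sdiff_of_subset (hsub u)]
    exact Nat.sub_le_sub_left (hmin u huW) _
  calc ((maximalIndepSets G W).card : ℝ)
      ≤ ∑ u ∈ closedNbhd G W v, ((maximalIndepSets G (W \ closedNbhd G W u)).card : ℝ) := by
        exact_mod_cast card_maximalIndepSets_le_sum hv
    _ ≤ k * r ^ (W.card - k) := by
        simpa [hk] using sum_le_sum hterm
    _ ≤ r ^ k * r ^ (W.card - k) := by gcongr
    _ = r ^ W.card := by
        rw [← pow_add, Nat.add_sub_cancel' (card_le_card (hsub v))]

theorem card_le_indepNum [Fintype V] (hs : ∀ u ∈ s, ∀ v ∈ s, ¬ G.Adj u v) :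
    s.card ≤ indepNum G := by
  classical
  exact le_sup (f := Finset.card) (mem_filter.2 ⟨mem_univ s, hs⟩)

/-- An independent set of size `α(G) - 1` is either maximal or obtained by deleting a vertex
from the unique maximum independent set. -/
theorem indepCount_indepNum_sub_one_add_one_le [Fintype V] [Nonempty V]
    (hxi : indepCount G (indepNum G) = 1) :
    indepCount G (indepNum G - 1) + 1 ≤
      Fintype.card V + (maximalIndepSets G (univ : Finset V)).card := by
  classical
  obtain ⟨M, hM⟩ := card_eq_one.1 hxi
  have hM_iff (s : Finset V) :
      (s.card = indepNum G ∧ ∀ u ∈ s, ∀ v ∈ s, ¬ G.Adj u v) ↔ s = M := by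
    simpa using congrArg (s ∈ ·) hM
  obtain ⟨hMcard, hMind⟩ := (hM_iff M).2 rfl
  have hpos : 0 < indepNum G := by
    obtain ⟨v⟩ := ‹Nonempty V›
    exact card_le_indepNum (G := G) (s := {v}) (by simp)
  have hMmax : M ∈ maximalIndepSets G (univ : Finset V) := by
    refine mem_maximalIndepSets.2 ⟨subset_univ _, hMind, fun w _ => ?_⟩
    by_contra! hw
    have hins : ∀ a ∈ insert w M, ∀ b ∈ insert w M, ¬ G.Adj a b := by
      simp only [mem_insert]
      rintro a (rfl | ha) b (rfl | hb) hab
      exacts [hab.ne rfl, hw.2 b hb hab.symm, hw.2 a ha hab, hMind a ha b hb hab]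
    have := card_le_indepNum hins
    rw [card_insert_of_notMem hw.1] at this
    lia
  have hcover : (univ.filter fun s : Finset V =>
      s.card = indepNum G - 1 ∧ ∀ u ∈ s, ∀ v ∈ s, ¬ G.Adj u v) ⊆
        M.image M.erase ∪ (maximalIndepSets G univ).erase M := by
    intro s hs
    obtain ⟨hscard, hsind⟩ := (mem_filter.1 hs).2
    rw [mem_union, mem_erase, mem_image]
    by_cases hmax : ∀ w, w ∈ s ∨ ∃ u ∈ s, G.Adj u w
    · refine Or.inr ⟨?_, mem_maximalIndepSets.2 ⟨subset_univ _, hsind, fun w _ => hmax w⟩⟩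
      rintro rfl
      lia
    · push Not at hmax
      obtain ⟨w, hws, hadj⟩ := hmax
      have hins : insert w s = M := by
        refine (hM_iff _).1 ⟨by rw [card_insert_of_notMem hws]; lia, ?_⟩
        simp only [mem_insert]
        rintro a (rfl | ha) b (rfl | hb) hab
        exacts [hab.ne rfl, hadj b hb hab.symm, hadj a ha hab, hsind a ha b hb hab]
      exact Or.inl ⟨w, hins ▸ mem_insert_self w s, by rw [← hins, erase_insert hws]⟩
  have hle : indepCount G (indepNum G - 1) ≤
      M.card + ((maximalIndepSets G univ).card - 1) := by
    rw [← card_erase_of_mem hMmax]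
    refine (le_of_eq ?_).trans ((card_le_card hcover).trans ((card_union_le _ _).trans
      (Nat.add_le_add_right card_image_le _)))
    rfl
  have hMle := card_le_univ M
  have := card_pos.2 ⟨M, hMmax⟩
  lia

end

/-- If a graph `G` on `n` vertices has exactly one maximum independent set, then the number of
independent sets of size `α(G) - 1` is at most `3^(n/3) + n - 1`. -/
theorem stmt4 {V : Type*} [Fintype V] {n : ℕ} (hn : 1 ≤ n) (hcard : Fintype.card V = n)
    (G : SimpleGraph V) (hxi : indepCount G (indepNum G) = 1) :
    (indepCount G (indepNum G - 1) : ℝ) ≤ (3 : ℝ) ^ ((n : ℝ) / 3) + n - 1 := by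
  have : Nonempty V := Fintype.card_pos_iff.1 (by lia)
  have hr3 : ((3 : ℝ) ^ (1 / 3 : ℝ)) ^ 3 = 3 := by
    rw [← Real.rpow_mul_natCast (by norm_num)]
    norm_num
  have hmoon := card_maximalIndepSets_le_pow (G := G)
    (Real.one_le_rpow (by norm_num : (1 : ℝ) ≤ 3) (by norm_num)) hr3 univ
  rw [← Real.rpow_mul_natCast (by norm_num), card_univ, hcard, one_div_mul_eq_div] at hmoon
  have hcount : (indepCount G (indepNum G - 1) : ℝ) + 1 ≤
      n + (maximalIndepSets G (univ : Finset V)).card := by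
    exact_mod_cast hcard ▸ indepCount_indepNum_sub_one_add_one_le hxi
  linarith
end

section
/- Let F be a forest (a finite simple graph with no cycles) on n ≥ 1 vertices with independence polynomial i(F,x) = ∑_{k=0}^{α(F)} i_k x^k. Then for every k with 0 ≤ k ≤ α(F) - 1, the ratio i_k / i_{k+1} is at most 2^((n-1)/2) + (n-1)/2 if n is odd, and at most 2^((n-2)/2) + n/2 if n is even. -/
open Finset Polynomial

open scoped Classical in
/-- The number of independent sets of size `k` contained in `W`. -/
noncomputable def indepCountIn {V : Type*} (G : SimpleGraph V) (W : Finset V) (k : ℕ) : ℕ :=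
  ((W.powersetCard k).filter fun s => ∀ u ∈ s, ∀ v ∈ s, ¬ G.Adj u v).card

section IndepCountIn

variable {V : Type*} {G : SimpleGraph V} {W W' : Finset V} {k : ℕ}

theorem indepCountIn_univ [Fintype V] : indepCountIn G Finset.univ k = indepCount G k := by
  unfold indepCountIn indepCount
  congr 1
  ext s
  simp [Finset.mem_powersetCard]

theorem indepCountIn_zero : indepCountIn G W 0 = 1 := by
  refine Finset.card_eq_one.2 ⟨∅, ?_⟩
  ext s
  simp only [Finset.mem_filter, Finset.powersetCard_zero, Finset.mem_singleton]
  exact ⟨And.left, fun h => ⟨h, by simp [h]⟩⟩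

theorem indepCountIn_mono (h : W ⊆ W') : indepCountIn G W k ≤ indepCountIn G W' k :=
  Finset.card_le_card fun s hs => by
    simp only [Finset.mem_filter] at hs ⊢
    exact ⟨Finset.powersetCard_mono h hs.1, hs.2⟩

theorem indepCountIn_pos_iff : 0 < indepCountIn G W k ↔
    ∃ s ⊆ W, s.card = k ∧ ∀ u ∈ s, ∀ v ∈ s, ¬ G.Adj u v := by
  simp only [indepCountIn, Finset.card_pos, Finset.Nonempty, Finset.mem_filter,
    Finset.mem_powersetCard, and_assoc]

theorem indepCountIn_pos_of_le {j : ℕ} (hjk : j ≤ k) (h : 0 < indepCountIn G W k) :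
    0 < indepCountIn G W j := by
  obtain ⟨s, hsW, hs, hi⟩ := indepCountIn_pos_iff.1 h
  obtain ⟨t, hts, ht⟩ := Finset.exists_subset_card_eq (hs ▸ hjk)
  exact indepCountIn_pos_iff.2
    ⟨t, hts.trans hsW, ht, fun u hu v hv => hi u (hts hu) v (hts hv)⟩

theorem le_card_of_indepCountIn_pos (h : 0 < indepCountIn G W k) : k ≤ W.card := by
  obtain ⟨s, hsW, rfl, -⟩ := indepCountIn_pos_iff.1 h
  exact Finset.card_le_card hsW

open scoped Classical in
theorem indepCountIn_succ {v : V} (hv : v ∈ W) :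
    indepCountIn G W (k + 1) = indepCountIn G (W.erase v) (k + 1) +
      indepCountIn G ((W.erase v).filter fun w => ¬ G.Adj v w) k := by
  unfold indepCountIn
  rw [← Finset.card_filter_add_card_filter_not (fun s : Finset V => v ∉ s)]
  congr 1
  · congr 1
    ext s
    simp only [Finset.mem_filter, Finset.mem_powersetCard, Finset.subset_erase]
    tauto
  · refine Finset.card_bij' (fun s _ => s.erase v) (fun s _ => insert v s) ?_ ?_ ?_ ?_
    · intro s hs
      simp only [Finset.mem_filter, Finset.mem_powersetCard, not_not] at hs ⊢
      obtain ⟨⟨⟨hsW, hc⟩, hi⟩, hvs⟩ := hs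
      refine ⟨⟨fun w hw => ?_, by rw [Finset.card_erase_of_mem hvs, hc]; rfl⟩,
        fun u hu w hw => hi u (Finset.mem_of_mem_erase hu) w (Finset.mem_of_mem_erase hw)⟩
      have hws := Finset.mem_of_mem_erase hw
      simp only [Finset.mem_filter, Finset.mem_erase]
      exact ⟨⟨Finset.ne_of_mem_erase hw, hsW hws⟩, hi v hvs w hws⟩
    · intro s hs
      simp only [Finset.mem_filter, Finset.mem_powersetCard, not_not] at hs ⊢
      obtain ⟨⟨hsW, hc⟩, hi⟩ := hs
      have hmem : ∀ w ∈ s, (w ≠ v ∧ w ∈ W) ∧ ¬ G.Adj v w := fun w hw => by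
        simpa using hsW hw
      have hvs : v ∉ s := fun h => (hmem v h).1.1 rfl
      refine ⟨⟨⟨?_, by rw [Finset.card_insert_of_notMem hvs, hc]⟩, ?_⟩,
        Finset.mem_insert_self _ _⟩
      · exact Finset.insert_subset hv fun w hw => (hmem w hw).1.2
      · intro a ha b hb
        rcases Finset.mem_insert.1 ha with rfl | has <;>
          rcases Finset.mem_insert.1 hb with rfl | hbs
        · exact G.loopless.irrefl _
        · exact (hmem b hbs).2
        · exact fun h => (hmem a has).2 h.symm
        · exact hi a has b hbs
    · intro s hs
      simp only [Finset.mem_filter, not_not] at hs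
      exact Finset.insert_erase hs.2
    · intro s hs
      simp only [Finset.mem_filter, Finset.mem_powersetCard] at hs
      exact Finset.erase_insert fun h => by simpa using hs.1.1 h

open scoped Classical in
theorem indepCountIn_succ_of_isolated {v : V} (hv : v ∈ W) (h : ∀ w ∈ W, ¬ G.Adj v w) :
    indepCountIn G W (k + 1) =
      indepCountIn G (W.erase v) (k + 1) + indepCountIn G (W.erase v) k := by
  rw [indepCountIn_succ hv, Finset.filter_true_of_mem fun w hw => h w (Finset.mem_of_mem_erase hw)]

open scoped Classical in
theorem indepCountIn_succ_of_leaf {u v : V} (hu : u ∈ W) (hv : v ∈ W) (huv : G.Adj v u)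
    (h : ∀ w ∈ W, G.Adj v w → w = u) :
    indepCountIn G W (k + 1) =
      indepCountIn G ((W.erase u).erase v) (k + 1) + indepCountIn G ((W.erase u).erase v) k +
        indepCountIn G ((W.erase u).filter fun w => ¬ G.Adj u w) k := by
  rw [indepCountIn_succ hu, indepCountIn_succ_of_isolated (v := v)]
  · exact Finset.mem_erase.2 ⟨huv.ne, hv⟩
  · exact fun w hw hvw => Finset.ne_of_mem_erase hw (h w (Finset.mem_of_mem_erase hw) hvw)

end IndepCountIn

/-- Every nonempty finite vertex set of an acyclic graph contains a vertex with at most one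
neighbour in the set. -/
theorem SimpleGraph.IsAcyclic.exists_mem_forall_adj_eq {V : Type*} {G : SimpleGraph V}
    (hG : G.IsAcyclic) {W : Finset V} (hW : W.Nonempty) :
    ∃ v ∈ W, ∀ a ∈ W, ∀ b ∈ W, G.Adj v a → G.Adj v b → a = b := by
  classical
  obtain ⟨r, hr⟩ := hW
  set H := G.induce (W : Set V)
  have hH : H.IsAcyclic := hG.induce _
  set c := H.connectedComponentMk ⟨r, hr⟩
  have hT := hH.isTree_connectedComponent c
  have key : ∃ v : c, ∀ a b : c, c.toSimpleGraph.Adj v a → c.toSimpleGraph.Adj v b → a = b := by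
    rcases subsingleton_or_nontrivial c with hs | hn
    · exact ⟨⟨_, rfl⟩, fun a b _ _ => Subsingleton.elim a b⟩
    · obtain ⟨v, hv⟩ := hT.exists_vert_degree_one_of_nontrivial
      obtain ⟨w, -, hw⟩ := SimpleGraph.degree_eq_one_iff_existsUnique_adj.1 hv
      exact ⟨v, fun a b ha hb => (hw a ha).trans (hw b hb).symm⟩
  obtain ⟨⟨v, hvc⟩, hv⟩ := key
  have lift : ∀ a (ha : a ∈ W), G.Adj v a → (⟨a, ha⟩ : (W : Set V)) ∈ c.supp := fun a ha hva =>
    c.mem_supp_of_adj_mem_supp hvc (show H.Adj v ⟨a, ha⟩ from hva)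
  refine ⟨v, v.2, fun a ha b hb hva hvb => ?_⟩
  simpa using hv ⟨⟨a, ha⟩, lift a ha hva⟩ ⟨⟨b, hb⟩, lift b hb hvb⟩ hva hvb

/-- A case distinction for nonempty vertex sets of an acyclic graph: there is an isolated vertex
or a leaf. -/
theorem SimpleGraph.IsAcyclic.exists_isolated_or_leaf {V : Type*} {G : SimpleGraph V}
    (hG : G.IsAcyclic) {W : Finset V} (hW : W.Nonempty) :
    (∃ v ∈ W, ∀ w ∈ W, ¬ G.Adj v w) ∨
      ∃ u ∈ W, ∃ v ∈ W, G.Adj v u ∧ ∀ w ∈ W, G.Adj v w → w = u := by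
  obtain ⟨v, hv, h⟩ := hG.exists_mem_forall_adj_eq hW
  by_cases hu : ∃ u ∈ W, G.Adj v u
  · obtain ⟨u, hu, huv⟩ := hu
    exact .inr ⟨u, hu, v, hv, huv, fun w hw hvw => h w hw u hu hvw huv⟩
  · exact .inl ⟨v, hv, fun w hw hvw => hu ⟨w, hw, hvw⟩⟩

open scoped Classical in
theorem filter_not_adj_subset_erase_erase {V : Type*} {G : SimpleGraph V} {W : Finset V}
    {u v : V} (huv : G.Adj v u) :
    ((W.erase u).filter fun w => ¬ G.Adj u w) ⊆ (W.erase u).erase v := by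
  intro w hw
  obtain ⟨hw, huw⟩ := Finset.mem_filter.1 hw
  exact Finset.mem_erase.2 ⟨fun h => huw (h ▸ huv.symm), hw⟩

/-- A forest on `m` vertices has at most `2 ^ (m / 2)` maximum independent sets. -/
theorem SimpleGraph.IsAcyclic.indepCountIn_le_two_pow {V : Type*} {G : SimpleGraph V}
    (hG : G.IsAcyclic) (W : Finset V) (k : ℕ) (h : indepCountIn G W (k + 1) = 0) :
    indepCountIn G W k ≤ 2 ^ (W.card / 2) := by
  classical
  induction hm : W.card using Nat.strong_induction_on generalizing W k with
  | _ m ih =>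
  subst hm
  rcases k with _ | k
  · rw [indepCountIn_zero]
    exact Nat.one_le_two_pow
  rcases W.eq_empty_or_nonempty with rfl | hW
  · rw [Nat.eq_zero_of_not_pos fun hp => absurd (le_card_of_indepCountIn_pos hp) (by simp)]
    exact Nat.zero_le _
  rcases hG.exists_isolated_or_leaf hW with ⟨v, hv, hiso⟩ | ⟨u, hu, v, hv, huv, hleaf⟩
  · rw [indepCountIn_succ_of_isolated hv hiso] at h ⊢
    have hcard := Finset.card_erase_add_one hv
    have h1 := ih _ (by omega) (W.erase v) k (by omega) rfl
    have h2 : 2 ^ ((W.erase v).card / 2) ≤ 2 ^ (W.card / 2) :=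
      Nat.pow_le_pow_right two_pos (by omega)
    omega
  · rw [indepCountIn_succ_of_leaf hu hv huv hleaf] at h ⊢
    have hcard := Finset.card_erase_add_one hu
    have hcard' := Finset.card_erase_add_one (Finset.mem_erase.2 ⟨huv.ne, hv⟩ : v ∈ W.erase u)
    have hle := Finset.card_le_card (filter_not_adj_subset_erase_erase (W := W) huv)
    have h1 := ih _ (by omega) ((W.erase u).erase v) k (by omega) rfl
    have h2 := ih _ (by omega) ((W.erase u).filter fun w => ¬ G.Adj u w) k (by omega) rfl
    have h3 := Nat.pow_le_pow_right two_pos (Nat.div_le_div_right (c := 2) hle)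
    have h4 : 2 ^ (W.card / 2) = 2 * 2 ^ (((W.erase u).erase v).card / 2) := by
      rw [← pow_succ']
      congr 1
      omega
    omega

/-- The maximal ratio of consecutive independent set counts of a forest on `n ≥ 1` vertices. -/
def forestRatio (n : ℕ) : ℕ := 2 ^ ((n - 1) / 2) + n / 2

theorem forestRatio_mono : Monotone forestRatio := fun a b h =>
  Nat.add_le_add (Nat.pow_le_pow_right two_pos (by omega)) (by omega)

theorem one_le_forestRatio (n : ℕ) : 1 ≤ forestRatio n :=
  Nat.one_le_two_pow.trans (Nat.le_add_right _ _)

theorem forestRatio_add_three (n : ℕ) :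
    forestRatio (n + 3) = 1 + forestRatio (n + 1) + 2 ^ (n / 2) := by
  have h1 : (n + 3 - 1) / 2 = n / 2 + 1 := by omega
  have h2 : (n + 3) / 2 = (n + 1) / 2 + 1 := by omega
  simp only [forestRatio, h1, h2, pow_succ, Nat.add_sub_cancel]
  omega

theorem one_add_forestRatio_le (n : ℕ) : 1 + forestRatio (n + 1) ≤ forestRatio (n + 2) := by
  rcases Nat.even_or_odd' n with ⟨m, rfl | rfl⟩
  · have h1 : (2 * m + 2 - 1) / 2 = m := by omega
    have h2 : (2 * m + 1 - 1) / 2 = m := by omega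
    simp only [forestRatio, h1, h2]
    omega
  · have h1 : (2 * m + 1 + 2 - 1) / 2 = m + 1 := by omega
    have h2 : (2 * m + 1 + 1 - 1) / 2 = m := by omega
    have h3 : 1 ≤ 2 ^ m := Nat.one_le_two_pow
    simp only [forestRatio, h1, h2, pow_succ]
    omega

theorem SimpleGraph.IsAcyclic.indepCountIn_le_forestRatio_mul {V : Type*} {G : SimpleGraph V}
    (hG : G.IsAcyclic) (W : Finset V) (k : ℕ) (h : 0 < indepCountIn G W (k + 1)) :
    indepCountIn G W k ≤ forestRatio W.card * indepCountIn G W (k + 1) := by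
  classical
  induction hm : W.card using Nat.strong_induction_on generalizing W k with
  | _ m ih =>
  subst hm
  rcases k with _ | k
  · rw [indepCountIn_zero]
    exact Nat.mul_pos (one_le_forestRatio _) h
  have hW : W.Nonempty := Finset.card_pos.1 (by have := le_card_of_indepCountIn_pos h; omega)
  rcases hG.exists_isolated_or_leaf hW with ⟨v, hv, hiso⟩ | ⟨u, hu, v, hv, huv, hleaf⟩
  · have hcard := Finset.card_erase_add_one hv
    rw [indepCountIn_succ_of_isolated hv hiso] at h ⊢
    rw [indepCountIn_succ_of_isolated hv hiso]
    have hpos : 0 < indepCountIn G (W.erase v) (k + 1) := by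
      by_contra h0
      exact h0 (indepCountIn_pos_of_le (Nat.le_succ _)
        (by omega : 0 < indepCountIn G _ (k + 1 + 1)))
    have h1 := ih _ (by omega) (W.erase v) k hpos rfl
    obtain ⟨n, hn⟩ : ∃ n, (W.erase v).card = n + 1 :=
      Nat.exists_eq_succ_of_ne_zero (by have := le_card_of_indepCountIn_pos hpos; omega)
    have hr := one_add_forestRatio_le n
    rw [← hcard]
    rw [hn] at h1 ⊢
    nlinarith
  · have hcard := Finset.card_erase_add_one hu
    have hcard' := Finset.card_erase_add_one (Finset.mem_erase.2 ⟨huv.ne, hv⟩ : v ∈ W.erase u)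
    have hsub := filter_not_adj_subset_erase_erase (W := W) huv
    rw [indepCountIn_succ_of_leaf hu hv huv hleaf] at h ⊢
    rw [indepCountIn_succ_of_leaf hu hv huv hleaf]
    set H := (W.erase u).erase v
    set H' := (W.erase u).filter fun w => ¬ G.Adj u w
    have hle := Finset.card_le_card hsub
    have hpos : 0 < indepCountIn G H (k + 1) := by
      have hmono := indepCountIn_mono (G := G) (k := k + 1) hsub
      by_contra h0
      exact h0 (indepCountIn_pos_of_le (Nat.le_succ _)
        (by omega : 0 < indepCountIn G _ (k + 1 + 1)))
    have h1 := ih _ (by omega) H k hpos rfl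
    obtain ⟨n, hn⟩ : ∃ n, H.card = n + 1 :=
      Nat.exists_eq_succ_of_ne_zero (by have := le_card_of_indepCountIn_pos hpos; omega)
    have hWn : W.card = n + 3 := by omega
    have hr := forestRatio_add_three n
    rw [hWn]
    rw [hn] at h1
    rcases Nat.eq_zero_or_pos (indepCountIn G H' (k + 1)) with h0 | hpos'
    · have hlt : H'.card < H.card := Finset.card_lt_card <| hsub.ssubset_of_ne fun heq => by
        rw [heq] at h0
        omega
      have h2 := (hG.indepCountIn_le_two_pow H' k h0).trans
        (Nat.pow_le_pow_right two_pos (Nat.div_le_div_right (c := 2) (by omega : H'.card ≤ n)))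
      rw [hr]
      nlinarith
    · have h2 := (ih _ (by omega) H' k hpos' rfl).trans
        (Nat.mul_le_mul_right _ (forestRatio_mono (by omega : H'.card ≤ n + 3)))
      have h3 : 1 + forestRatio (n + 1) ≤ forestRatio (n + 3) := hr ▸ Nat.le_add_right _ _
      nlinarith

/-- For a forest `F` on `n ≥ 1` vertices and `0 ≤ k ≤ α(F) - 1`, the ratio `i_k / i_{k+1}` of
consecutive independence polynomial coefficients is at most `2^((n-1)/2) + (n-1)/2` if `n` is
odd and at most `2^((n-2)/2) + n/2` if `n` is even. -/
theorem stmt8 {V : Type*} [Fintype V] {n : ℕ} (hn : 1 ≤ n) (hcard : Fintype.card V = n)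
    (F : SimpleGraph V) (hF : F.IsAcyclic) (k : ℕ) (hk : k + 1 ≤ indepNum F) :
    (indepCount F k : ℝ) / (indepCount F (k + 1) : ℝ) ≤
      if Odd n then (2 : ℝ) ^ (((n : ℝ) - 1) / 2) + ((n : ℝ) - 1) / 2
      else (2 : ℝ) ^ (((n : ℝ) - 2) / 2) + (n : ℝ) / 2 := by
  classical
  have hpos : 0 < indepCountIn F Finset.univ (k + 1) := by
    obtain ⟨s, hs, hsc⟩ := (Finset.le_sup_iff (Nat.succ_pos k)).1 hk
    exact indepCountIn_pos_of_le hsc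
      (indepCountIn_pos_iff.2 ⟨s, Finset.subset_univ _, rfl, (Finset.mem_filter.1 hs).2⟩)
  have hle := hF.indepCountIn_le_forestRatio_mul Finset.univ k hpos
  rw [Finset.card_univ, hcard, indepCountIn_univ, indepCountIn_univ] at hle
  rw [indepCountIn_univ] at hpos
  have hdiv : (indepCount F k : ℝ) / (indepCount F (k + 1) : ℝ) ≤ forestRatio n := by
    rw [div_le_iff₀ (by exact_mod_cast hpos)]
    exact_mod_cast hle
  refine hdiv.trans (le_of_eq ?_)
  split_ifs with hodd
  · obtain ⟨m, rfl⟩ := hodd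
    have h1 : ((2 * m + 1 : ℕ) - 1 : ℝ) / 2 = m := by push_cast; ring
    have h2 : (2 * m + 1) / 2 = m := by omega
    rw [h1, Real.rpow_natCast, forestRatio, Nat.add_sub_cancel, h2,
      Nat.mul_div_cancel_left _ two_pos]
    push_cast
    rfl
  · obtain ⟨m, rfl⟩ : ∃ m, n = 2 * (m + 1) := by
      obtain ⟨m, rfl⟩ := (Nat.not_odd_iff_even.1 hodd).exists_two_nsmul
      exact ⟨m - 1, by simp only [smul_eq_mul] at hn ⊢; omega⟩
    have h1 : ((2 * (m + 1) : ℕ) - 2 : ℝ) / 2 = m := by push_cast; ring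
    have h2 : (2 * (m + 1) - 1) / 2 = m := by omega
    rw [h1, Real.rpow_natCast, forestRatio, h2, Nat.mul_div_cancel_left _ two_pos]
    push_cast
    ring
end

section
/- For every integer k ≥ 1, the real polynomial f(x) = (1 + 3x)^k + x(1 + x)^k has a real root in the interval (-∞, -3^k); i.e., there exists a real number x with x < -3^k and f(x) = 0. -/
/-- For every `k ≥ 1`, the polynomial `(1 + 3x)^k + x(1 + x)^k` has a real root in
`(-∞, -3^k)`. -/
theorem stmt12 (k : ℕ) (hk : 1 ≤ k) :
    ∃ x : ℝ, x < -(3 : ℝ) ^ k ∧ (1 + 3 * x) ^ k + x * (1 + x) ^ k = 0 := by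
  have hk0 : k ≠ 0 := by omega
  have h3 : (3 : ℝ) ≤ 3 ^ k := le_self_pow₀ (by norm_num) hk0
  have h35 : (3 : ℝ) ^ k ≤ 5 ^ k := pow_le_pow_left₀ (by norm_num) (by norm_num) k
  let g : ℝ → ℝ := fun t => (3 * t - 1) ^ k - t * (t - 1) ^ k
  have hpos : 0 < g (3 ^ k) := by
    have h : (3 * ((3 : ℝ) ^ k - 1)) ^ k < (3 * 3 ^ k - 1) ^ k :=
      pow_lt_pow_left₀ (by linarith) (by linarith) hk0
    rw [mul_pow] at h
    exact sub_pos.mpr h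
  have hneg : g (5 ^ k) ≤ 0 := by
    have h : (3 * (5 : ℝ) ^ k - 1) ^ k ≤ (5 * (5 ^ k - 1)) ^ k :=
      pow_le_pow_left₀ (by linarith) (by linarith) k
    rw [mul_pow] at h
    exact sub_nonpos.mpr h
  have hcont : ContinuousOn g (Set.Icc (3 ^ k) (5 ^ k)) := by
    dsimp only [g]
    fun_prop
  obtain ⟨t, ht, hgt⟩ := intermediate_value_Icc' h35 hcont ⟨hneg, hpos.le⟩
  have hne : (3 : ℝ) ^ k ≠ t := by
    rintro rfl
    exact hpos.ne' hgt
  refine ⟨-t, neg_lt_neg (lt_of_le_of_ne ht.1 hne), ?_⟩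
  have h1 : 1 + 3 * -t = (-1) * (3 * t - 1) := by ring
  have h2 : 1 + -t = (-1) * (t - 1) := by ring
  rw [h1, h2, mul_pow, mul_pow]
  linear_combination (-1) ^ k * hgt
end

section
/- For every integer k ≥ 1, the real polynomial f(x) = (1 + 3x)^k (1 + 2x) + x(1 + x)^(k+1) has a real root in the interval (-∞, -3^k); i.e., there exists a real number x with x < -3^k and f(x) = 0. -/
/-- The polynomial of `stmt13` at `-t`, with its sign factored out. -/
theorem eval_neg_eq (k : ℕ) (t : ℝ) :
    (1 + 3 * -t) ^ k * (1 + 2 * -t) + -t * (1 + -t) ^ (k + 1) =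
      (-1) ^ k * (t * (t - 1) ^ (k + 1) - (2 * t - 1) * (3 * t - 1) ^ k) := by
  rw [show 1 + 3 * -t = -1 * (3 * t - 1) by ring, show 1 + -t = -1 * (t - 1) by ring,
    mul_pow, mul_pow]
  ring

theorem sub_neg_at_three_pow (k : ℕ) :
    (3 : ℝ) ^ k * (3 ^ k - 1) ^ (k + 1) - (2 * 3 ^ k - 1) * (3 * 3 ^ k - 1) ^ k < 0 := by
  have ht : (1 : ℝ) ≤ 3 ^ k := one_le_pow₀ (by norm_num)
  have hpow : (3 : ℝ) ^ k * (3 ^ k - 1) ^ k ≤ (3 * 3 ^ k - 1) ^ k := by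
    rw [← mul_pow]
    exact pow_le_pow_left₀ (by linarith) (by linarith) k
  have hpos : (0 : ℝ) < (3 * 3 ^ k - 1) ^ k := pow_pos (by linarith) k
  have hmul := mul_le_mul_of_nonneg_right hpow (sub_nonneg.2 ht)
  have hlt : (0 : ℝ) < (3 * 3 ^ k - 1) ^ k * 3 ^ k := by positivity
  rw [pow_succ ((3 : ℝ) ^ k - 1)]
  linarith

theorem sub_nonneg_at_two_mul_five_pow_add_one (k : ℕ) (t : ℝ) (ht : t = 2 * 5 ^ k + 1) :
    0 ≤ t * (t - 1) ^ (k + 1) - (2 * t - 1) * (3 * t - 1) ^ k := by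
  have h5 : (1 : ℝ) ≤ 5 ^ k := one_le_pow₀ (by norm_num)
  have hpow : (3 * t - 1) ^ k ≤ 5 ^ k * (t - 1) ^ k := by
    rw [← mul_pow]
    exact pow_le_pow_left₀ (by linarith) (by linarith) k
  have hpos : 0 ≤ (3 * t - 1) ^ k := pow_nonneg (by linarith) k
  have hmul := mul_le_mul_of_nonneg_left hpow (show 0 ≤ 2 * t by linarith)
  have hlead : t * (t - 1) ^ (k + 1) = 2 * t * (5 ^ k * (t - 1) ^ k) := by
    rw [pow_succ, show t - 1 = 2 * 5 ^ k by linarith]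
    ring
  linarith

/-- For every `k ≥ 1`, the polynomial `(1 + 3x)^k (1 + 2x) + x(1 + x)^(k+1)` has a real root in
`(-∞, -3^k)`. -/
theorem stmt13 (k : ℕ) (hk : 1 ≤ k) :
    ∃ x : ℝ, x < -(3 : ℝ) ^ k ∧
      (1 + 3 * x) ^ k * (1 + 2 * x) + x * (1 + x) ^ (k + 1) = 0 := by
  have h35 : (3 : ℝ) ^ k ≤ 2 * 5 ^ k + 1 := by
    have : (3 : ℝ) ^ k ≤ 5 ^ k := pow_le_pow_left₀ (by norm_num) (by norm_num) k
    have : (0 : ℝ) < 5 ^ k := by positivity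
    linarith
  have hcont : ContinuousOn
      (fun t : ℝ => t * (t - 1) ^ (k + 1) - (2 * t - 1) * (3 * t - 1) ^ k)
      (Set.Icc (3 ^ k) (2 * 5 ^ k + 1)) := by fun_prop
  obtain ⟨t, ⟨ht, -⟩, hroot⟩ := intermediate_value_Ioc h35 hcont
    ⟨sub_neg_at_three_pow k, sub_nonneg_at_two_mul_five_pow_add_one k _ rfl⟩
  refine ⟨-t, neg_lt_neg ht, ?_⟩
  rw [eval_neg_eq]
  exact mul_eq_zero_of_right _ hroot
end

section
/- For every integer k ≥ 1, the real polynomial f(x) = (1 + 3x)^k (1 + 2x)^2 + x(1 + x)^(k+2) has a real root in the interval (-∞, -3^k); i.e., there exists a real number x with x < -3^k and f(x) = 0. -/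
/-- For every `k ≥ 1`, the polynomial `(1 + 3x)^k (1 + 2x)^2 + x(1 + x)^(k+2)` has a real root
in `(-∞, -3^k)`. -/
theorem stmt14 (k : ℕ) (hk : 1 ≤ k) :
    ∃ x : ℝ, x < -(3 : ℝ) ^ k ∧
      (1 + 3 * x) ^ k * (1 + 2 * x) ^ 2 + x * (1 + x) ^ (k + 2) = 0 := by
  -- Up to sign, the value of the polynomial at `-t` is `g t`.
  let g : ℝ → ℝ := fun t ↦ (3 * t - 1) ^ k * (2 * t - 1) ^ 2 - t * (t - 1) ^ (k + 2)
  have h3 : (3 : ℝ) ≤ 3 ^ k := le_self_pow₀ (by norm_num) (by omega)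
  have h34 : (3 : ℝ) ^ k ≤ 9 * 4 ^ k := by
    have h : (3 : ℝ) ^ k ≤ 4 ^ k := by gcongr; norm_num
    linarith
  have hpos : 0 < g (3 ^ k) := by
    have key : ∀ t : ℝ, 3 ≤ t →
        (3 : ℝ) ^ k * (t - 1) ^ (k + 2) < (3 * t - 1) ^ k * (2 * t - 1) ^ 2 := by
      intro t ht
      have h1 : (3 * (t - 1)) ^ k ≤ (3 * t - 1) ^ k :=
        pow_le_pow_left₀ (by linarith) (by linarith) k
      have h2 : (t - 1) ^ 2 < (2 * t - 1) ^ 2 := by nlinarith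
      have h0 : 0 < (3 * t - 1) ^ k := pow_pos (by linarith) k
      calc (3 : ℝ) ^ k * (t - 1) ^ (k + 2) = (3 * (t - 1)) ^ k * (t - 1) ^ 2 := by
            rw [mul_pow, pow_add]; ring
        _ ≤ (3 * t - 1) ^ k * (t - 1) ^ 2 := by gcongr
        _ < (3 * t - 1) ^ k * (2 * t - 1) ^ 2 := by gcongr
    exact sub_pos.2 (key _ h3)
  have hneg : g (9 * 4 ^ k) ≤ 0 := by
    have key : ∀ t : ℝ, 3 ≤ t →
        (3 * t - 1) ^ k * (2 * t - 1) ^ 2 ≤ 9 * 4 ^ k * (t - 1) ^ (k + 2) := by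
      intro t ht
      have h1 : (3 * t - 1) ^ k ≤ (4 * (t - 1)) ^ k :=
        pow_le_pow_left₀ (by linarith) (by linarith) k
      have h2 : (2 * t - 1) ^ 2 ≤ (3 * (t - 1)) ^ 2 :=
        pow_le_pow_left₀ (by linarith) (by linarith) 2
      have h0 : 0 ≤ (4 * (t - 1)) ^ k := pow_nonneg (by linarith) k
      calc (3 * t - 1) ^ k * (2 * t - 1) ^ 2 ≤ (4 * (t - 1)) ^ k * (3 * (t - 1)) ^ 2 :=
            mul_le_mul h1 h2 (sq_nonneg _) h0
        _ = 9 * 4 ^ k * (t - 1) ^ (k + 2) := by rw [mul_pow, pow_add]; ring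
    exact sub_nonpos.2 (key _ (h3.trans h34))
  have hcont : Continuous g := by fun_prop
  obtain ⟨t, ht, hgt⟩ := intermediate_value_Icc' h34 hcont.continuousOn ⟨hneg, hpos.le⟩
  refine ⟨-t, neg_lt_neg (lt_of_le_of_ne ht.1 ?_), ?_⟩
  · rintro rfl
    exact hpos.ne' hgt
  · have e1 : (1 + 3 * -t) ^ k = (-1) ^ k * (3 * t - 1) ^ k := by rw [← mul_pow]; ring
    have e2 : (1 + -t) ^ (k + 2) = (-1) ^ k * (t - 1) ^ (k + 2) := by
      rw [pow_add, pow_add, ← mul_assoc, ← mul_pow]; ring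
    rw [e1, e2]
    linear_combination (-1) ^ k * hgt
end

section
/- For every integer k ≥ 1, the real polynomial f(x) = (1 + 2x)^k + x(1 + x)^k has a real root in the interval [-2^k - k, -2^k); in particular it has a real root x with x < -2^k. -/
theorem pos_at_two_pow {k : ℕ} (hk : 1 ≤ k) :
    (2 : ℝ) ^ k * ((2 : ℝ) ^ k - 1) ^ k < (2 * (2 : ℝ) ^ k - 1) ^ k := by
  have hN : (1 : ℝ) ≤ 2 ^ k := one_le_pow₀ (by norm_num)
  rw [← mul_pow]
  exact pow_lt_pow_left₀ (by linarith) (by linarith) (by omega)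

theorem nonpos_at_two_pow_add {k : ℕ} (hk : 1 ≤ k) :
    (2 * ((2 : ℝ) ^ k + k) - 1) ^ k ≤ ((2 : ℝ) ^ k + k) * ((2 : ℝ) ^ k + k - 1) ^ k := by
  have hN : (1 : ℝ) ≤ 2 ^ k := one_le_pow₀ (by norm_num)
  have hk' : (1 : ℝ) ≤ k := by exact_mod_cast hk
  set N : ℝ := 2 ^ k with hNdef
  set a : ℝ := 2 * (N + k) - 1 with ha
  have ha0 : 0 < a := by linarith
  have bernoulli : 1 - k / a ≤ ((2 * (N + k - 1)) / a) ^ k := by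
    have h := one_add_mul_le_pow (a := -(1 / a)) (by
      have : 1 / a ≤ 1 := by rw [div_le_one ha0]; linarith
      linarith) k
    have e : (2 * (N + k - 1)) / a = 1 + -(1 / a) := by
      field_simp
      rw [ha]; ring
    rw [e]
    calc 1 - k / a = 1 + k * -(1 / a) := by ring
      _ ≤ _ := h
  rw [div_pow, le_div_iff₀ (by positivity), mul_pow, ← hNdef] at bernoulli
  have key : N ≤ (N + k) * (1 - k / a) := by
    have e : (N + k) * (1 - k / a) = (N + k) * (a - k) / a := by field_simp
    rw [e, le_div_iff₀ ha0, ha]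
    nlinarith
  have hak : 0 < a ^ k := by positivity
  refine le_of_mul_le_mul_left ?_ (by linarith : 0 < N)
  calc N * a ^ k ≤ (N + k) * (1 - k / a) * a ^ k := by gcongr
    _ = (N + k) * ((1 - k / a) * a ^ k) := by ring
    _ ≤ (N + k) * (N * (N + k - 1) ^ k) := by gcongr
    _ = _ := by ring

/-- For every `k ≥ 1`, the polynomial `(1 + 2x)^k + x(1 + x)^k` has a real root in
`[-2^k - k, -2^k)`; in particular it has a real root `x < -2^k`. -/
theorem stmt15 (k : ℕ) (hk : 1 ≤ k) :
    ∃ x : ℝ, -(2 : ℝ) ^ k - k ≤ x ∧ x < -(2 : ℝ) ^ k ∧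
      (1 + 2 * x) ^ k + x * (1 + x) ^ k = 0 := by
  have hle : (2 : ℝ) ^ k ≤ 2 ^ k + k := le_add_of_nonneg_right (Nat.cast_nonneg k)
  obtain ⟨y, ⟨hy₁, hy₂⟩, hy⟩ := intermediate_value_Icc' hle
    (f := fun y : ℝ => (2 * y - 1) ^ k - y * (y - 1) ^ k) (by fun_prop)
    ⟨sub_nonpos.2 (nonpos_at_two_pow_add hk), (sub_pos.2 (pos_at_two_pow hk)).le⟩
  have hne : (2 : ℝ) ^ k ≠ y := by
    rintro rfl
    exact (sub_pos.2 (pos_at_two_pow hk)).ne' hy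
  refine ⟨-y, by linarith, neg_lt_neg (lt_of_le_of_ne hy₁ hne), ?_⟩
  have h₁ : 1 + 2 * -y = -1 * (2 * y - 1) := by ring
  have h₂ : 1 + -y = -1 * (y - 1) := by ring
  rw [h₁, h₂, mul_pow, mul_pow]
  linear_combination (-1) ^ k * hy
end

section
/- For every integer k ≥ 2, the real polynomial f(x) = (1 + 2x)^k (1 + 5x + 6x² + 2x³) + x(1 + x)^k (1 + 4x + 4x² + x³) has a real root in the interval (-∞, -2^k); i.e., there exists a real number x with x < -2^k and f(x) = 0. -/
/-- Substituting `x = -y` in the polynomial of `stmt16` and dividing by `1 - y` gives, up to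
sign, an expression with a root `y > 2 ^ k`. -/
theorem exists_reflected_cofactor_root (k : ℕ) (hk : 2 ≤ k) :
    ∃ y : ℝ, 2 ^ k < y ∧
      (2 * y - 1) ^ k * (2 * y ^ 2 - 4 * y + 1) - y * (y - 1) ^ k * (y ^ 2 - 3 * y + 1) = 0 := by
  have h4 : (4 : ℝ) ≤ 2 ^ k := by
    calc (4 : ℝ) = 2 ^ 2 := by norm_num
      _ ≤ 2 ^ k := pow_le_pow_right₀ (by norm_num) hk
  have h27 : (27 : ℝ) ≤ 3 ^ (k + 1) := by
    calc (27 : ℝ) = 3 ^ 3 := by norm_num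
      _ ≤ 3 ^ (k + 1) := pow_le_pow_right₀ (by norm_num) (by omega)
  have hle : (2 : ℝ) ^ k ≤ 3 ^ (k + 1) :=
    calc (2 : ℝ) ^ k ≤ 3 ^ k := by gcongr; norm_num
      _ ≤ 3 ^ (k + 1) := pow_le_pow_right₀ (by norm_num) (by omega)
  let h : ℝ → ℝ := fun y =>
    (2 * y - 1) ^ k * (2 * y ^ 2 - 4 * y + 1) - y * (y - 1) ^ k * (y ^ 2 - 3 * y + 1)
  have hpos : 0 < h (2 ^ k) := by
    have key : ∀ y : ℝ, 4 ≤ y → 2 ^ k = y → 0 < h y := by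
      intro y hy hky
      have hpow : y * (y - 1) ^ k ≤ (2 * y - 1) ^ k := by
        rw [← hky, ← mul_pow, hky]
        exact pow_le_pow_left₀ (by linarith) (by linarith) k
      have hp : 0 < (2 * y - 1) ^ k := pow_pos (by linarith) k
      have hq : 0 < y ^ 2 - 3 * y + 1 := by nlinarith
      have hlt : y ^ 2 - 3 * y + 1 < 2 * y ^ 2 - 4 * y + 1 := by nlinarith
      exact sub_pos.2 ((mul_le_mul_of_nonneg_right hpow hq.le).trans_lt
        (mul_lt_mul_of_pos_left hlt hp))
    exact key _ h4 rfl
  have hneg : h (3 ^ (k + 1)) ≤ 0 := by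
    have key : ∀ y : ℝ, 27 ≤ y → 3 ^ k * 3 = y → h y ≤ 0 := by
      intro y hy hky
      have hpow : (2 * y - 1) ^ k ≤ 3 ^ k * (y - 1) ^ k := by
        rw [← mul_pow]
        exact pow_le_pow_left₀ (by linarith) (by linarith) k
      have hq : 0 ≤ 2 * y ^ 2 - 4 * y + 1 := by nlinarith
      have hle : 2 * y ^ 2 - 4 * y + 1 ≤ 3 * (y ^ 2 - 3 * y + 1) := by nlinarith
      have hp : 0 ≤ 3 ^ k * (y - 1) ^ k :=
        mul_nonneg (by positivity) (pow_nonneg (by linarith) k)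
      refine sub_nonpos.2 ?_
      calc (2 * y - 1) ^ k * (2 * y ^ 2 - 4 * y + 1)
          ≤ 3 ^ k * (y - 1) ^ k * (3 * (y ^ 2 - 3 * y + 1)) := mul_le_mul hpow hle hq hp
        _ = 3 ^ k * 3 * (y - 1) ^ k * (y ^ 2 - 3 * y + 1) := by ring
        _ = y * (y - 1) ^ k * (y ^ 2 - 3 * y + 1) := by rw [hky]
    exact key _ h27 (pow_succ 3 k).symm
  have hcont : Continuous h := by fun_prop
  obtain ⟨y, hy, hy0⟩ := intermediate_value_Icc' hle hcont.continuousOn ⟨hneg, hpos.le⟩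
  refine ⟨y, lt_of_le_of_ne hy.1 ?_, hy0⟩
  rintro rfl
  exact hpos.ne' hy0

/-- For every `k ≥ 2`, the polynomial
`(1 + 2x)^k (1 + 5x + 6x² + 2x³) + x(1 + x)^k (1 + 4x + 4x² + x³)` has a real root in
`(-∞, -2^k)`. -/
theorem stmt16 (k : ℕ) (hk : 2 ≤ k) :
    ∃ x : ℝ, x < -(2 : ℝ) ^ k ∧
      (1 + 2 * x) ^ k * (1 + 5 * x + 6 * x ^ 2 + 2 * x ^ 3) +
        x * (1 + x) ^ k * (1 + 4 * x + 4 * x ^ 2 + x ^ 3) = 0 := by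
  obtain ⟨y, hy, hy0⟩ := exists_reflected_cofactor_root k hk
  refine ⟨-y, neg_lt_neg hy, ?_⟩
  have h₁ : (1 + 2 * -y) ^ k = (-1) ^ k * (2 * y - 1) ^ k := by rw [← mul_pow]; ring
  have h₂ : (1 + -y) ^ k = (-1) ^ k * (y - 1) ^ k := by rw [← mul_pow]; ring
  rw [h₁, h₂]
  linear_combination (-1) ^ k * (1 - y) * hy0
end

section
/- For every odd integer n ≥ 3 there exists a tree T on n vertices such that the independence polynomial i(T,x) = ∑_{k=0}^{α(T)} i_k x^k satisfies i_{α(T)-1} / i_{α(T)} = 2^((n-1)/2) + (n-1)/2; that is, the upper bound on consecutive coefficient ratios of independence polynomials of forests on an odd number of vertices is attained. -/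
open Finset Polynomial

theorem forall_not_adj_map_iff {V W : Type*} {G : SimpleGraph V} {H : SimpleGraph W}
    (e : G ≃g H) (s : Finset V) :
    (∀ u ∈ s.map e.toEquiv.toEmbedding, ∀ v ∈ s.map e.toEquiv.toEmbedding, ¬ H.Adj u v) ↔
      ∀ u ∈ s, ∀ v ∈ s, ¬ G.Adj u v := by
  simp only [forall_mem_map]
  exact forall₂_congr fun u _ => forall₂_congr fun v _ => not_congr e.map_adj_iff

theorem indepCount_congr {V W : Type*} [Fintype V] [Fintype W] {G : SimpleGraph V}
    {H : SimpleGraph W} (e : G ≃g H) (k : ℕ) : indepCount G k = indepCount H k := by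
  unfold indepCount
  refine Finset.card_equiv e.toEquiv.finsetCongr fun s => ?_
  simp only [mem_filter, mem_univ, true_and, Equiv.finsetCongr_apply, card_map,
    forall_not_adj_map_iff e]

theorem indepNum_congr {V W : Type*} [Fintype V] [Fintype W] {G : SimpleGraph V}
    {H : SimpleGraph W} (e : G ≃g H) : indepNum G = indepNum H := by
  unfold indepNum
  apply le_antisymm
  · refine Finset.sup_le fun s hs => ?_
    rw [← card_map e.toEquiv.toEmbedding]
    refine Finset.le_sup (f := Finset.card) ?_
    simpa only [mem_filter, mem_univ, true_and, forall_not_adj_map_iff e] using hs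
  · refine Finset.sup_le fun s hs => ?_
    rw [← card_map e.symm.toEquiv.toEmbedding]
    refine Finset.le_sup (f := Finset.card) ?_
    simpa only [mem_filter, mem_univ, true_and, forall_not_adj_map_iff e.symm] using hs

/-- The parent of a vertex in the rooted spider with legs of length two: `none` is the root,
`some (i, false)` is the middle vertex of leg `i` and `some (i, true)` is its leaf. -/
def spiderParent {m : ℕ} : Option (Fin m × Bool) → Option (Fin m × Bool)
  | some (i, true) => some (i, false)
  | _ => none

/-- The spider obtained by gluing `m` copies of the path on three vertices at a leaf. -/
def spider (m : ℕ) : SimpleGraph (Option (Fin m × Bool)) :=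
  SimpleGraph.fromRel fun u v => spiderParent u = v

theorem spider_adj_parent {m : ℕ} (x : Fin m × Bool) :
    (spider m).Adj (some x) (spiderParent (some x)) := by
  obtain ⟨i, _ | _⟩ := x <;> simp [spider, spiderParent]

theorem spider_connected (m : ℕ) : (spider m).Connected := by
  have root (v) : (spider m).Reachable v none := by
    have mid (i : Fin m) : (spider m).Reachable (some (i, false)) none :=
      (spider_adj_parent (i, false)).reachable
    obtain _ | ⟨i, _ | _⟩ := v
    · exact .refl _
    · exact mid i
    · exact (spider_adj_parent (i, true)).reachable.trans (mid i)
  exact { preconnected := fun u v => (root u).trans (root v).symm, nonempty := ⟨none⟩ }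

theorem spider_edgeSet (m : ℕ) : (spider m).edgeSet =
    Set.range fun x : Fin m × Bool => s(some x, spiderParent (some x)) := by
  ext e
  constructor
  · induction e with | _ u v
    rintro ⟨hne, h | h⟩
    · obtain _ | x := u
      · exact absurd h hne
      · exact ⟨x, by simp [h]⟩
    · obtain _ | x := v
      · exact absurd h.symm hne
      · exact ⟨x, by simp [h, Sym2.eq_swap]⟩
  · rintro ⟨x, rfl⟩
    exact spider_adj_parent x

theorem spider_isTree (m : ℕ) : (spider m).IsTree := by
  rw [SimpleGraph.isTree_iff_connected_and_card]
  refine ⟨spider_connected m, ?_⟩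
  have inj : Function.Injective
      fun x : Fin m × Bool => s(some x, spiderParent (some x)) := by
    rintro ⟨i, _ | _⟩ ⟨j, _ | _⟩ <;> simp [spiderParent]
  rw [spider_edgeSet, Nat.card_range_of_injective inj]
  simp

theorem spider_indep_iff {m : ℕ} (s : Finset (Option (Fin m × Bool))) :
    (∀ u ∈ s, ∀ v ∈ s, ¬ (spider m).Adj u v) ↔
      ∀ i, some (i, false) ∈ s → none ∉ s ∧ some (i, true) ∉ s := by
  constructor
  · intro h i hi
    exact ⟨fun hn => h _ hi _ hn (spider_adj_parent (i, false)),
      fun ht => h _ ht _ hi (spider_adj_parent (i, true))⟩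
  · intro h
    have parent (x : Fin m × Bool) (hx : some x ∈ s) : spiderParent (some x) ∉ s := by
      obtain ⟨i, _ | _⟩ := x
      · exact (h i hx).1
      · exact fun hp => (h i hp).2 hx
    rintro u hu v hv ⟨hne, huv | huv⟩
    · obtain _ | x := u
      · exact hne huv
      · exact parent x hu (huv ▸ hv)
    · obtain _ | x := v
      · exact hne huv.symm
      · exact parent x hv (huv ▸ hu)

/-- The set consisting of one non-root vertex in each leg of the spider, as selected by `f`. -/
def spiderTransversal {m : ℕ} (f : Fin m → Bool) : Finset (Option (Fin m × Bool)) :=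
  univ.map ⟨fun i => some (i, f i), fun _ _ h => by simpa using congrArg (Option.map Prod.fst) h⟩

/-- The set consisting of the root and the leaves of the legs in `t`. -/
def spiderRootLeaves {m : ℕ} (t : Finset (Fin m)) : Finset (Option (Fin m × Bool)) :=
  insertNone (t.map ⟨fun i => (i, true), fun _ _ h => congrArg Prod.fst h⟩)

@[simp] theorem card_spiderTransversal {m : ℕ} (f : Fin m → Bool) :
    (spiderTransversal f).card = m := by
  simp [spiderTransversal]

@[simp] theorem card_spiderRootLeaves {m : ℕ} (t : Finset (Fin m)) :
    (spiderRootLeaves t).card = t.card + 1 := by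
  simp [spiderRootLeaves]

@[simp] theorem none_notMem_spiderTransversal {m : ℕ} (f : Fin m → Bool) :
    none ∉ spiderTransversal f := by
  simp [spiderTransversal]

@[simp] theorem some_mem_spiderTransversal {m : ℕ} (f : Fin m → Bool) (i : Fin m) (b : Bool) :
    some (i, b) ∈ spiderTransversal f ↔ f i = b := by
  simp only [spiderTransversal, mem_map, mem_univ, true_and]
  change (∃ j, some (j, f j) = some (i, b)) ↔ f i = b
  simp

@[simp] theorem none_mem_spiderRootLeaves {m : ℕ} (t : Finset (Fin m)) :
    none ∈ spiderRootLeaves t := by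
  simp [spiderRootLeaves]

@[simp] theorem some_mem_spiderRootLeaves {m : ℕ} (t : Finset (Fin m)) (i : Fin m) (b : Bool) :
    some (i, b) ∈ spiderRootLeaves t ↔ i ∈ t ∧ b = true := by
  simp only [spiderRootLeaves, some_mem_insertNone, mem_map]
  change (∃ j ∈ t, (j, true) = (i, b)) ↔ i ∈ t ∧ b = true
  simp [eq_comm]

theorem spiderTransversal_injective {m : ℕ} :
    Function.Injective (spiderTransversal (m := m)) := fun f g h => by
  funext i
  have : some (i, f i) ∈ spiderTransversal g := h ▸ (by simp)
  exact ((some_mem_spiderTransversal g i _).1 this).symm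

theorem spiderRootLeaves_injective {m : ℕ} :
    Function.Injective (spiderRootLeaves (m := m)) := fun t u h => by
  ext i
  simpa using congrArg (some (i, true) ∈ ·) h

theorem exists_eq_spiderRootLeaves {m : ℕ} {s : Finset (Option (Fin m × Bool))}
    (hs : ∀ i, some (i, false) ∈ s → none ∉ s ∧ some (i, true) ∉ s) (hn : none ∈ s) :
    ∃ t, s = spiderRootLeaves t := by
  refine ⟨univ.filter fun i => some (i, true) ∈ s, ?_⟩
  ext (_ | ⟨i, _ | _⟩)
  · simp [hn]
  · simpa using fun h => (hs i h).1 hn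
  · simp

theorem legs_injOn_of_indep {m : ℕ} {s : Finset (Option (Fin m × Bool))}
    (hs : ∀ i, some (i, false) ∈ s → none ∉ s ∧ some (i, true) ∉ s) :
    Set.InjOn Prod.fst (eraseNone s : Set (Fin m × Bool)) := by
  rintro ⟨i, b⟩ hb ⟨j, c⟩ hc (rfl : i = j)
  simp only [mem_coe, mem_eraseNone] at hb hc
  have := hs i
  cases b <;> cases c <;> simp_all

theorem card_le_of_indep {m : ℕ} {s : Finset (Option (Fin m × Bool))}
    (hs : ∀ i, some (i, false) ∈ s → none ∉ s ∧ some (i, true) ∉ s) (hn : none ∉ s) :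
    s.card ≤ m := by
  rw [← card_eraseNone_of_not_mem hn, ← card_image_of_injOn (legs_injOn_of_indep hs)]
  simpa using card_le_univ (image Prod.fst (eraseNone s))

theorem exists_eq_spiderTransversal {m : ℕ} {s : Finset (Option (Fin m × Bool))}
    (hs : ∀ i, some (i, false) ∈ s → none ∉ s ∧ some (i, true) ∉ s) (hn : none ∉ s)
    (hc : s.card = m) : ∃ f, s = spiderTransversal f := by
  have surj : image Prod.fst (eraseNone s) = univ := by
    rw [← card_eq_iff_eq_univ, card_image_of_injOn (legs_injOn_of_indep hs),
      card_eraseNone_of_not_mem hn, hc, Fintype.card_fin]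
  refine ⟨fun i => decide (some (i, true) ∈ s), (eq_of_subset_of_card_le ?_ (by simp [hc])).symm⟩
  rintro (_ | ⟨i, b⟩) h
  · simp at h
  · have hi : i ∈ image Prod.fst (eraseNone s) := surj ▸ mem_univ i
    simp at h hi
    cases b <;> simp_all

theorem spiderTransversal_indep {m : ℕ} (f : Fin m → Bool) (i : Fin m)
    (h : some (i, false) ∈ spiderTransversal f) :
    none ∉ spiderTransversal f ∧ some (i, true) ∉ spiderTransversal f := by
  simp_all

theorem spiderRootLeaves_indep {m : ℕ} (t : Finset (Fin m)) (i : Fin m)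
    (h : some (i, false) ∈ spiderRootLeaves t) :
    none ∉ spiderRootLeaves t ∧ some (i, true) ∉ spiderRootLeaves t := by
  simp at h

theorem indepNum_spider (m : ℕ) : indepNum (spider m) = m + 1 := by
  unfold indepNum
  simp only [spider_indep_iff]
  apply le_antisymm
  · refine Finset.sup_le fun s hs => ?_
    simp only [mem_filter, mem_univ, true_and] at hs
    by_cases hn : none ∈ s
    · obtain ⟨t, rfl⟩ := exists_eq_spiderRootLeaves hs hn
      simpa using card_le_univ t
    · exact (card_le_of_indep hs hn).trans m.le_succ
  · refine le_trans (by simp) (Finset.le_sup (f := Finset.card) (b := spiderRootLeaves univ) ?_)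
    simpa only [mem_filter, mem_univ, true_and] using spiderRootLeaves_indep univ

theorem indepCount_spider_succ (m : ℕ) : indepCount (spider m) (m + 1) = 1 := by
  unfold indepCount
  simp only [spider_indep_iff]
  rw [card_eq_one]
  refine ⟨spiderRootLeaves univ, ?_⟩
  ext s
  simp only [mem_filter, mem_univ, true_and, mem_singleton]
  constructor
  · rintro ⟨hc, hs⟩
    by_cases hn : none ∈ s
    · obtain ⟨t, rfl⟩ := exists_eq_spiderRootLeaves hs hn
      rw [(card_eq_iff_eq_univ t).1 (by simpa using hc)]
    · have := card_le_of_indep hs hn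
      omega
  · rintro rfl
    exact ⟨by simp, spiderRootLeaves_indep univ⟩

theorem indepCount_spider_self (m : ℕ) (hm : 1 ≤ m) :
    indepCount (spider m) m = 2 ^ m + m := by
  classical
  have key : (univ.filter fun s : Finset (Option (Fin m × Bool)) =>
      s.card = m ∧ ∀ u ∈ s, ∀ v ∈ s, ¬ (spider m).Adj u v) =
      univ.image spiderTransversal ∪ (powersetCard (m - 1) univ).image spiderRootLeaves := by
    ext s
    simp only [spider_indep_iff, mem_filter, mem_univ, true_and, mem_union, mem_image,
      mem_powersetCard, subset_univ]
    constructor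
    · rintro ⟨hc, hs⟩
      by_cases hn : none ∈ s
      · obtain ⟨t, rfl⟩ := exists_eq_spiderRootLeaves hs hn
        rw [card_spiderRootLeaves] at hc
        exact .inr ⟨t, by omega, rfl⟩
      · obtain ⟨f, rfl⟩ := exists_eq_spiderTransversal hs hn hc
        exact .inl ⟨f, rfl⟩
    · rintro (⟨f, rfl⟩ | ⟨t, ht, rfl⟩)
      · exact ⟨card_spiderTransversal f, spiderTransversal_indep f⟩
      · exact ⟨by rw [card_spiderRootLeaves]; omega, spiderRootLeaves_indep t⟩
  have disj : Disjoint (univ.image (spiderTransversal (m := m)))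
      ((powersetCard (m - 1) univ).image spiderRootLeaves) := by
    simp only [disjoint_left, mem_image]
    rintro _ ⟨f, -, rfl⟩ ⟨t, -, h⟩
    exact none_notMem_spiderTransversal f (h ▸ none_mem_spiderRootLeaves t)
  unfold indepCount
  refine Eq.trans (by congr) ((congrArg card key).trans ?_)
  rw [card_union_of_disjoint disj, card_image_of_injective _ spiderTransversal_injective,
    card_image_of_injective _ spiderRootLeaves_injective, card_powersetCard, card_univ, card_univ,
    Fintype.card_fin, Nat.choose_symm hm, Nat.choose_one_right]
  simp

/-- For every odd `n ≥ 3` there is a tree `T` on `n` vertices whose independence polynomial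
attains the maximum consecutive coefficient ratio `i_{α(T)-1}/i_{α(T)} = 2^((n-1)/2) + (n-1)/2`. -/
theorem stmt17 (n : ℕ) (hn : 3 ≤ n) (hodd : Odd n) :
    ∃ T : SimpleGraph (Fin n), T.IsTree ∧
      (indepCount T (indepNum T - 1) : ℝ) / (indepCount T (indepNum T) : ℝ) =
        (2 : ℝ) ^ (((n : ℝ) - 1) / 2) + ((n : ℝ) - 1) / 2 := by
  obtain ⟨m, rfl⟩ := hodd
  have hcard : Fintype.card (Option (Fin m × Bool)) = 2 * m + 1 := by simp [mul_comm]
  let e := Fintype.equivFinOfCardEq hcard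
  let iso : spider m ≃g (spider m).map e.toEmbedding := SimpleGraph.Iso.map e (spider m)
  refine ⟨(spider m).map e.toEmbedding, iso.isTree_iff.1 (spider_isTree m), ?_⟩
  have hexp : (((2 * m + 1 : ℕ) : ℝ) - 1) / 2 = m := by push_cast; ring
  rw [← indepCount_congr iso, ← indepCount_congr iso, ← indepNum_congr iso, indepNum_spider,
    Nat.add_sub_cancel, indepCount_spider_succ, indepCount_spider_self m (by omega), hexp,
    Real.rpow_natCast]
  simp
end
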